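/- Let G be a group, A and B subgroups of G with A a proper subgroup of G (i.e., [G : A] > 1), and let φ : A → B be a group isomorphism with HNN extension Γ = ⟨G, t | t⁻¹ a t = φ(a), a ∈ A⟩. Define A_1 = A, A_k = {a ∈ A : φ(a) ∈ A_{k-1}} for k ≥ 2, F_k = {a ∈ A_k : φ^k(a) = a}, F_∞ = ⋃_{k ≥ 1} F_k, and Fix(φ) = F_1 = {a ∈ A : φ(a) = a}. If F_∞ = Fix(φ) and Fix(φ) is a normal subgroup of G, then the FC-centre K(Γ) equals the image, under the canonical embedding of G in Γ, of K(G) ∩ Fix(φ). -/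

import Mathlib

/-- The FC-centre of a group: the subgroup of elements whose centralizer has finite index. -/
def FCCentre (Γ : Type*) [Group Γ] : Subgroup Γ where
  carrier := {γ | (Subgroup.centralizer {γ}).FiniteIndex}
  one_mem' := by
    have h : Subgroup.centralizer ({1} : Set Γ) = ⊤ := by
      ext g; simp [Subgroup.mem_centralizer_iff]
    simp only [Set.mem_setOf_eq, h]
    infer_instance
  mul_mem' := by
    intro a b ha hb
    simp only [Set.mem_setOf_eq] at *
    have hle : Subgroup.centralizer {a} ⊓ Subgroup.centralizer {b} ≤
        Subgroup.centralizer {a * b} := by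
      rintro g ⟨hga, hgb⟩
      rw [Subgroup.mem_centralizer_iff] at *
      intro h hh
      rcases hh with rfl
      have h1 := hga a rfl
      have h2 := hgb b rfl
      calc a * b * g = a * (b * g) := by group
        _ = a * (g * b) := by rw [h2]
        _ = (a * g) * b := by group
        _ = (g * a) * b := by rw [h1]
        _ = g * (a * b) := by group
    haveI := ha; haveI := hb
    exact Subgroup.finiteIndex_of_le hle
  inv_mem' := by
    intro a ha
    simp only [Set.mem_setOf_eq] at *
    have h : Subgroup.centralizer ({a⁻¹} : Set Γ) = Subgroup.centralizer {a} := by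
      ext g
      simp only [Subgroup.mem_centralizer_iff, Set.mem_singleton_iff, forall_eq]
      constructor
      · intro h; have := congrArg (fun x => a * x * a) h
        group at this ⊢; simpa [mul_assoc] using this.symm
      · intro h; have := congrArg (fun x => a⁻¹ * x * a⁻¹) h
        group at this ⊢; simpa [mul_assoc] using this.symm
    rw [h]; exact ha

theorem mem_FCCentre_iff {Γ : Type*} [Group Γ] (γ : Γ) :
    γ ∈ FCCentre Γ ↔ (Subgroup.centralizer {γ}).FiniteIndex := Iff.rfl

/-- The partial map `G → G` induced by the partial isomorphism `φ : A ≃* B`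
(with junk value `1` off `A`). -/
noncomputable def partialIter {G : Type*} [Group G] {A B : Subgroup G} (φ : A ≃* B) (g : G) : G :=
  letI := Classical.dec (g ∈ A)
  if h : g ∈ A then ((φ ⟨g, h⟩ : B) : G) else 1

/-- `domainIter φ k` is the set `A_k` of elements on which the `k`-fold iterate `φ^k` is
defined: `A_1 = A` and `A_k = {a ∈ A : φ(a) ∈ A_{k-1}}` for `k ≥ 2`. -/
def domainIter {G : Type*} [Group G] {A B : Subgroup G} (φ : A ≃* B) (k : ℕ) : Set G :=
  {a | ∀ j < k, (partialIter φ)^[j] a ∈ A}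

/-- `fixIter φ k` is the set `F_k = {a ∈ A_k : φ^k(a) = a}`. -/
def fixIter {G : Type*} [Group G] {A B : Subgroup G} (φ : A ≃* B) (k : ℕ) : Set G :=
  {a | a ∈ domainIter φ k ∧ (partialIter φ)^[k] a = a}

theorem List.isChain_replicate_append_cons {α : Type*} {R : α → α → Prop} {x y : α}
    {l : List α} (n : ℕ) (hxx : R x x) (hxy : R x y) (hl : (y :: l).IsChain R) :
    (List.replicate n x ++ y :: l).IsChain R := by
  refine (List.isChain_replicate_of_rel n hxx).append hl ?_
  intro a ha b hb
  obtain rfl : a = x := List.eq_of_mem_replicate (List.mem_of_mem_getLast? ha)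
  obtain rfl : y = b := by simpa using hb
  exact hxy

theorem exists_commute_pow_of_mem_FCCentre {Γ : Type*} [Group Γ] {γ : Γ} (hγ : γ ∈ FCCentre Γ)
    (x : Γ) : ∃ m : ℕ, 0 < m ∧ Commute γ (x ^ m) := by
  obtain ⟨m, hm, -, h⟩ := Subgroup.exists_pow_mem_of_index_ne_zero
    ((mem_FCCentre_iff γ).1 hγ).index_ne_zero x
  exact ⟨m, hm, (Subgroup.mem_centralizer_singleton_iff.1 h).symm⟩

namespace HNNExtension

open Multiplicative

variable {G : Type*} [Group G] {A B : Subgroup G} (φ : A ≃* B)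

/-- The element `t ^ u₁ * g₁ * ⋯ * t ^ uₙ * gₙ` of the HNN extension spelled by the list
`[(u₁, g₁), …, (uₙ, gₙ)]`. -/
def wordProd (l : List (ℤˣ × G)) : HNNExtension G A B φ :=
  (l.map fun x => t ^ (x.1 : ℤ) * of x.2).prod

@[simp]
theorem wordProd_nil : wordProd φ [] = 1 := rfl

@[simp]
theorem wordProd_cons (x : ℤˣ × G) (l : List (ℤˣ × G)) :
    wordProd φ (x :: l) = t ^ (x.1 : ℤ) * of x.2 * wordProd φ l := by
  simp [wordProd]

@[simp]
theorem wordProd_append (l₁ l₂ : List (ℤˣ × G)) :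
    wordProd φ (l₁ ++ l₂) = wordProd φ l₁ * wordProd φ l₂ := by
  simp [wordProd]

@[simp]
theorem wordProd_replicate_one (n : ℕ) (u : ℤˣ) :
    wordProd φ (List.replicate n (u, 1)) = (t ^ (u : ℤ)) ^ n := by
  simp [wordProd]

theorem exists_wordProd (x : HNNExtension G A B φ) :
    ∃ (g : G) (l : List (ℤˣ × G)), x = of g * wordProd φ l := by
  obtain ⟨d⟩ := NormalWord.TransversalPair.nonempty G A B
  exact ⟨_, _, ((NormalWord.equiv φ d).left_inv x).symm⟩

/-- Right multiplication by an element of the base group does not change the length of a word. -/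
theorem exists_wordProd_mul_of (g h : G) (l : List (ℤˣ × G)) :
    ∃ (g' : G) (l' : List (ℤˣ × G)), l'.length = l.length ∧
      of g * wordProd φ l * of h = of g' * wordProd φ l' := by
  induction l generalizing g with
  | nil => exact ⟨g * h, [], rfl, by simp⟩
  | cons x l ih =>
    obtain ⟨g', l', hl, h'⟩ := ih x.2
    refine ⟨g, (x.1, g') :: l', by simp [hl], ?_⟩
    simp only [wordProd_cons, mul_assoc] at h' ⊢
    rw [h']

theorem exists_zpow_mul_of_eq (u : ℤˣ) {a : G} (ha : a ∈ toSubgroup A B u) :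
    ∃ b : G, (t ^ (u : ℤ) * of a : HNNExtension G A B φ) = of b * t ^ (u : ℤ) := by
  rcases Int.units_eq_one_or u with rfl | rfl
  · exact ⟨φ ⟨a, ha⟩, by simpa using t_mul_of (φ := φ) ⟨a, ha⟩⟩
  · refine ⟨φ.symm ⟨a, ha⟩, ?_⟩
    rw [equiv_symm_eq_conj]
    simp

/-- If a word does not satisfy Britton's reducedness condition, then it can be shortened. -/
theorem exists_shorter_of_not_isChain (g : G) (l : List (ℤˣ × G))
    (hl : ¬ l.IsChain (fun a b => a.2 ∈ toSubgroup A B a.1 → a.1 = b.1)) :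
    ∃ (g' : G) (l' : List (ℤˣ × G)), l'.length < l.length ∧
      of g * wordProd φ l = of g' * wordProd φ l' := by
  rw [List.isChain_iff_forall_rel_of_append_cons_cons] at hl
  push Not at hl
  obtain ⟨⟨u, a⟩, ⟨v, b⟩, l₁, l₂, rfl, ha, huv⟩ := hl
  obtain ⟨c, hc⟩ := exists_zpow_mul_of_eq φ u ha
  obtain rfl : v = -u := Int.units_ne_iff_eq_neg.1 (Ne.symm huv)
  obtain ⟨g', l', hl', h'⟩ := exists_wordProd_mul_of φ g (c * b) l₁
  refine ⟨g', l' ++ l₂, by simp [hl'], ?_⟩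
  rw [wordProd_append, wordProd_append, wordProd_cons, wordProd_cons, ← mul_assoc (of g'), ← h',
    hc]
  simp [mul_assoc]

/-- A power of `t` can be split off on the left of a word whose head allows it. -/
theorem exists_eq_zpow_mul_wordProd {g : G} {u : ℤˣ} (hg : g ∈ toSubgroup A B (-u)) (a : G)
    (l : List (ℤˣ × G)) :
    ∃ g' : G, of g * wordProd φ ((u, a) :: l) = t ^ (u : ℤ) * (of g' * wordProd φ l) := by
  obtain ⟨b, hb⟩ := exists_zpow_mul_of_eq φ (-u) hg
  refine ⟨b * a, ?_⟩
  have hb' : (of g * t ^ (u : ℤ) : HNNExtension G A B φ) = t ^ (u : ℤ) * of b := by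
    rw [← mul_right_inj (t ^ ((-u : ℤˣ) : ℤ)), ← mul_assoc, hb]
    simp
  rw [wordProd_cons, ← mul_assoc, ← mul_assoc, hb']
  simp [mul_assoc]

/-- A power of `t` can be split off on the right of a word whose last letter allows it. -/
theorem exists_eq_wordProd_mul_zpow (g : G) (l : List (ℤˣ × G)) {u : ℤˣ} {a : G}
    (ha : a ∈ toSubgroup A B u) :
    ∃ (g' : G) (l' : List (ℤˣ × G)), l'.length = l.length ∧
      of g * wordProd φ (l ++ [(u, a)]) = of g' * wordProd φ l' * t ^ (u : ℤ) := by
  obtain ⟨b, hb⟩ := exists_zpow_mul_of_eq φ u ha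
  obtain ⟨g', l', hl', h'⟩ := exists_wordProd_mul_of φ g b l
  refine ⟨g', l', hl', ?_⟩
  rw [← h']
  simp [hb, mul_assoc]

/-- If conjugation by `t ^ (n + 1)` maps `g` into the base group, then `g` lies in the domain of
the defining isomorphism. -/
theorem mem_of_conj_pow_mem_range {g : G} {n : ℕ}
    (h : t ^ (n + 1) * of g * (t ^ (n + 1))⁻¹ ∈
      (of : G →* HNNExtension G A B φ).range) : g ∈ A := by
  by_contra hg
  have hchain : (List.replicate n ((1 : ℤˣ), (1 : G)) ++
      (1, g) :: List.replicate (n + 1) (-1, 1)).IsChain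
      (fun a b : ℤˣ × G => a.2 ∈ toSubgroup A B a.1 → a.1 = b.1) := by
    refine List.isChain_replicate_append_cons n (fun _ => rfl) (fun _ => rfl) ?_
    refine List.isChain_cons.2 ⟨fun _ _ h => absurd h hg, ?_⟩
    exact List.isChain_replicate_of_rel _ fun _ => rfl
  let w : NormalWord.ReducedWord G A B := ⟨1, _, hchain⟩
  have hw : w.prod φ = t ^ (n + 1) * of g * (t ^ (n + 1))⁻¹ := by
    change of 1 * wordProd φ _ = _
    rw [wordProd_append, wordProd_cons, wordProd_replicate_one, wordProd_replicate_one]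
    simp only [map_one, one_mul, Units.val_neg, Units.val_one, zpow_neg, zpow_one, inv_pow]
    rw [pow_succ]
    simp only [mul_assoc]
  have := ReducedWord.toList_eq_nil_of_mem_of_range φ w (hw ▸ h)
  simp [w] at this

theorem partialIter_eq {g : G} (hg : g ∈ A) : partialIter φ g = φ ⟨g, hg⟩ := by
  simp [partialIter, hg]

theorem mem_domainIter_succ {g : G} {n : ℕ} :
    g ∈ domainIter φ (n + 1) ↔ g ∈ A ∧ partialIter φ g ∈ domainIter φ n := by
  refine ⟨fun h => ⟨h 0 (by lia), fun j hj => h (j + 1) (by lia)⟩, fun h j hj => ?_⟩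
  cases j with
  | zero => exact h.1
  | succ j => exact h.2 j (by lia)

theorem of_partialIter_iterate {g : G} {n : ℕ} (hg : g ∈ domainIter φ n) :
    (of ((partialIter φ)^[n] g) : HNNExtension G A B φ) = t ^ n * of g * (t ^ n)⁻¹ := by
  induction n generalizing g with
  | zero => simp
  | succ n ih =>
    obtain ⟨hgA, hg⟩ := (mem_domainIter_succ φ).1 hg
    rw [Function.iterate_succ_apply, ih hg, partialIter_eq φ hgA, equiv_eq_conj]
    simp [pow_succ, mul_assoc]

/-- `domainIter φ n` consists of the elements which conjugation by `t ^ n` maps into the base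
group. -/
theorem mem_domainIter_of_conj_pow_mem_range {g : G} {n : ℕ}
    (h : t ^ n * of g * (t ^ n)⁻¹ ∈ (of : G →* HNNExtension G A B φ).range) :
    g ∈ domainIter φ n := by
  induction n generalizing g with
  | zero => intro j hj; lia
  | succ n ih =>
    have hg := mem_of_conj_pow_mem_range φ h
    refine (mem_domainIter_succ φ).2 ⟨hg, ih ?_⟩
    rw [partialIter_eq φ hg, equiv_eq_conj]
    simpa [pow_succ, mul_assoc] using h

theorem mem_fixIter_of_commute {g : G} {n : ℕ}
    (h : Commute (of g : HNNExtension G A B φ) (t ^ n)) : g ∈ fixIter φ n := by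
  have h' : t ^ n * of g * (t ^ n)⁻¹ = (of g : HNNExtension G A B φ) := by
    rw [← h.eq, mul_inv_cancel_right]
  have hg : g ∈ domainIter φ n := mem_domainIter_of_conj_pow_mem_range φ ⟨g, h'.symm⟩
  exact ⟨hg, of_injective (φ := φ) ((of_partialIter_iterate φ hg).trans h')⟩

/-- An element of the base group commuting with a positive power of `t` is conjugated into the
base group by every power of `t`. -/
theorem conj_zpow_mem_range_of_commute {g : G} {n : ℕ} (hn : 0 < n)
    (h : Commute (of g : HNNExtension G A B φ) (t ^ n)) (i : ℤ) :
    t ^ i * of g * (t ^ i)⁻¹ ∈ (of : G →* HNNExtension G A B φ).range := by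
  obtain ⟨r, hr⟩ : ∃ r : ℕ, i % n = r := Int.eq_ofNat_of_zero_le (Int.emod_nonneg _ (by lia))
  have hrn : r < n := by have := Int.emod_lt_of_pos i (b := n) (by lia); lia
  have hg := (mem_fixIter_of_commute φ h).1
  refine ⟨(partialIter φ)^[r] g, ?_⟩
  rw [of_partialIter_iterate φ fun j hj => hg j (hj.trans hrn)]
  have hi : (t ^ i : HNNExtension G A B φ) = t ^ r * (t ^ n) ^ (i / n) := by
    rw [← zpow_natCast t r, ← hr, ← zpow_natCast t n, ← zpow_mul, ← zpow_add,
      Int.emod_add_mul_ediv]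
  rw [hi, mul_assoc (t ^ r) _ (of g), ← (h.zpow_right _).eq]
  group

/-- An element commuting with a positive power of the stable letter is the product of a power of
the stable letter with an element of the base group. -/
theorem exists_eq_zpow_mul_of_of_commute {x : HNNExtension G A B φ} {m : ℕ} (hm : 0 < m)
    (hx : Commute x (t ^ m)) : ∃ (k : ℤ) (g : G), x = t ^ k * of g := by
  have hex : ∃ (n : ℕ) (i j : ℤ) (g : G) (l : List (ℤˣ × G)), l.length = n ∧
      x = t ^ i * (of g * wordProd φ l) * t ^ j := by
    obtain ⟨g, l, h⟩ := exists_wordProd φ x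
    exact ⟨_, 0, 0, g, l, rfl, by simpa using h⟩
  classical
  obtain ⟨i, j, g, l, hln, h⟩ := Nat.find_spec hex
  have hmin {i' j' : ℤ} {g' : G} {l' : List (ℤˣ × G)}
      (hlt : l'.length < l.length) : x ≠ t ^ i' * (of g' * wordProd φ l') * t ^ j' :=
    fun h' => Nat.find_min hex (hln ▸ hlt) ⟨i', j', g', l', rfl, h'⟩
  have hcomm : Commute (of g * wordProd φ l : HNNExtension G A B φ) (t ^ m) := by
    have : of g * wordProd φ l = t ^ (-i) * x * t ^ (-j) := by rw [h]; group
    rw [this]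
    exact (((Commute.refl t).zpow_left _).pow_right _ |>.mul_left hx).mul_left
      (((Commute.refl t).zpow_left _).pow_right _)
  clear hln
  cases l with
  | nil =>
    obtain ⟨b, hb⟩ := conj_zpow_mem_range_of_commute φ hm (by simpa using hcomm) (-j)
    refine ⟨i + j, b, ?_⟩
    rw [h, hb]
    simp only [wordProd_nil]
    group
  | cons y l =>
    exfalso
    obtain ⟨u, a⟩ := y
    have hchain : ((u, a) :: l).IsChain (fun a b => a.2 ∈ toSubgroup A B a.1 → a.1 = b.1) := by
      by_contra hc
      obtain ⟨g', l', hlt, h'⟩ := exists_shorter_of_not_isChain φ g _ hc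
      exact hmin hlt (h' ▸ h)
    have hleft : g ∉ toSubgroup A B (-u) := by
      intro hg
      obtain ⟨g', h'⟩ := exists_eq_zpow_mul_wordProd φ hg a l
      refine hmin (l' := l) (by simp) (h.trans ?_) (i' := i + u) (j' := j) (g' := g')
      rw [h', zpow_add]
      simp only [mul_assoc]
    have hright : ∀ y ∈ ((u, a) :: l).getLast?, y.2 ∉ toSubgroup A B y.1 := by
      intro y hy hmem
      obtain ⟨l₀, hl₀⟩ := List.getLast?_eq_some_iff.1 hy
      obtain ⟨g', l', hl', h'⟩ := exists_eq_wordProd_mul_zpow φ g l₀ hmem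
      refine hmin (l' := l') (by rw [hl₀]; simp [hl']) (h.trans ?_) (i' := i)
        (j' := y.1 + j) (g' := g')
      rw [hl₀, h', zpow_add]
      simp only [mul_assoc]
    obtain ⟨m, rfl⟩ : ∃ n, m = n + 1 := ⟨m - 1, by lia⟩
    have hgA : g ∈ A → (1 : ℤˣ) = u := by
      intro hg
      by_contra hu
      rw [← ne_eq, Int.units_ne_iff_eq_neg] at hu
      exact hleft (by simpa [← hu] using hg)
    let w₁ : NormalWord.ReducedWord G A B :=
      ⟨1, List.replicate m (1, 1) ++ (1, g) :: (u, a) :: l,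
        List.isChain_replicate_append_cons m (fun _ => rfl) (fun _ => rfl)
          (List.isChain_cons_cons.2 ⟨hgA, hchain⟩)⟩
    let w₂ : NormalWord.ReducedWord G A B :=
      ⟨g, ((u, a) :: l) ++ List.replicate (m + 1) (1, 1),
        hchain.append (List.isChain_replicate_of_rel _ fun _ => rfl)
          fun y hy _ _ hmem => absurd hmem (hright y hy)⟩
    have hw : w₁.prod φ = w₂.prod φ := by
      change of 1 * wordProd φ _ = of g * wordProd φ _
      rw [wordProd_append, wordProd_append, wordProd_cons φ (1, g), wordProd_replicate_one,
        wordProd_replicate_one, ← mul_assoc (of g)]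
      simp only [Units.val_one, zpow_one]
      rw [hcomm.eq]
      simp only [map_one, one_mul, pow_succ, mul_assoc]
    obtain ⟨hfst, hhead⟩ := ReducedWord.map_fst_eq_and_of_prod_eq φ hw
    have hw₁ : w₁.toList.head?.map Prod.fst = some 1 := by cases m <;> simp [w₁, List.replicate]
    have hu : u = 1 := by
      have := congrArg List.head? hfst
      rw [List.head?_map, hw₁] at this
      simpa [w₂] using this.symm
    have := hhead 1 hw₁
    exact hleft (by simpa [hu, w₁, w₂] using this)

/-- The exponent sum of the stable letter. -/
def exponentSum : HNNExtension G A B φ →* Multiplicative ℤ :=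
  lift 1 (ofAdd 1) (by simp)

theorem eq_of_zpow_mul_of_eq_conj {k l : ℤ} {g g' h : G}
    (hk : (t ^ k * of g : HNNExtension G A B φ) = of h * (t ^ l * of g') * (of h)⁻¹) : k = l := by
  have := congrArg (exponentSum φ) hk
  simpa [exponentSum, ← ofAdd_zsmul, mul_comm] using this

theorem mem_FCCentre_of_of_mem {g : G} (hg : (of g : HNNExtension G A B φ) ∈ FCCentre _) :
    g ∈ FCCentre G := by
  rw [mem_FCCentre_iff] at hg ⊢
  have hle : (Subgroup.centralizer {(of g : HNNExtension G A B φ)}).comap of ≤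
      Subgroup.centralizer {g} := fun x hx => by
    rw [Subgroup.mem_comap, Subgroup.mem_centralizer_singleton_iff] at hx
    rw [Subgroup.mem_centralizer_singleton_iff]
    exact of_injective (φ := φ) (by simpa using hx)
  have : ((Subgroup.centralizer {(of g : HNNExtension G A B φ)}).comap of).FiniteIndex := by
    rw [Subgroup.finiteIndex_iff, Subgroup.index_comap]
    exact (Subgroup.instFiniteIndex_subgroupOf _ _).index_ne_zero
  exact Subgroup.finiteIndex_of_le hle

theorem exists_zpow_of_mem_FCCentre {x : HNNExtension G A B φ} (hx : x ∈ FCCentre _) (h : G) :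
    ∃ (k : ℤ) (g : G), x = of h * (t ^ k * of g) * (of h)⁻¹ := by
  obtain ⟨m, hm, hc⟩ := exists_commute_pow_of_mem_FCCentre hx (of h * t * (of h)⁻¹)
  rw [conj_pow] at hc
  have hc' : Commute ((of h)⁻¹ * x * of h) (t ^ m) := by
    have := congrArg (fun y => (of h)⁻¹ * y * of h) hc.eq
    simpa [mul_assoc, Commute, SemiconjBy] using this
  obtain ⟨k, g, hk⟩ := exists_eq_zpow_mul_of_of_commute φ hm hc'
  exact ⟨k, g, by rw [← hk]; group⟩

theorem nonneg_of_zpow_mul_of_mem_FCCentre (hA : A ≠ ⊤) {k : ℤ} {g : G}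
    (hx : (t ^ k * of g : HNNExtension G A B φ) ∈ FCCentre _) : 0 ≤ k := by
  by_contra! hk
  obtain ⟨h, hh⟩ : ∃ h, h ∉ A := by
    by_contra! hall
    exact hA (eq_top_iff.2 fun x _ => hall x)
  obtain ⟨l, g', hl⟩ := exists_zpow_of_mem_FCCentre φ hx h
  obtain rfl := eq_of_zpow_mul_of_eq_conj φ hl
  obtain ⟨n, rfl⟩ : ∃ n : ℕ, k = -((n + 1 : ℕ) : ℤ) := ⟨(-k - 1).toNat, by lia⟩
  refine hh (inv_mem_iff.1 (mem_of_conj_pow_mem_range φ (n := n) ⟨(g * h * g'⁻¹)⁻¹, ?_⟩))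
  rw [zpow_neg, zpow_natCast] at hl
  generalize (t ^ (n + 1) : HNNExtension G A B φ) = s at hl ⊢
  have hs : of h * s⁻¹ = s⁻¹ * of g * of h * (of g')⁻¹ := by
    rw [hl]
    group
  rw [map_inv, map_inv, ← inv_inj, mul_inv_rev, mul_inv_rev, inv_inv, inv_inv, inv_inv, hs]
  simp [mul_assoc]

theorem exists_of_eq_of_mem_FCCentre (hA : A ≠ ⊤) {x : HNNExtension G A B φ}
    (hx : x ∈ FCCentre _) : ∃ g : G, of g = x := by
  obtain ⟨k, g, h⟩ := exists_zpow_of_mem_FCCentre φ hx 1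
  obtain ⟨l, g', h'⟩ := exists_zpow_of_mem_FCCentre φ (inv_mem hx) 1
  simp only [map_one, one_mul, inv_one, mul_one] at h h'
  have hk := nonneg_of_zpow_mul_of_mem_FCCentre φ hA (h ▸ hx)
  have hl := nonneg_of_zpow_mul_of_mem_FCCentre φ hA (h' ▸ inv_mem hx)
  have hkl := congrArg (exponentSum φ) (h'.symm.trans (congrArg _ h))
  simp only [exponentSum, map_mul, map_zpow, lift_t, lift_of, map_inv, MonoidHom.one_apply,
    mul_one, ← ofAdd_zsmul, ← ofAdd_neg, EmbeddingLike.apply_eq_iff_eq, smul_eq_mul] at hkl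
  obtain rfl : k = 0 := by lia
  exact ⟨g, by simp [h]⟩

theorem mem_fixIter_one {a : G} : a ∈ fixIter φ 1 ↔ ∃ ha : a ∈ A, (φ ⟨a, ha⟩ : G) = a := by
  constructor
  · rintro ⟨ha, h⟩
    have haA : a ∈ A := ha 0 one_pos
    exact ⟨haA, by simpa [partialIter_eq φ haA] using h⟩
  · rintro ⟨ha, h⟩
    exact ⟨(mem_domainIter_succ φ).2 ⟨ha, fun j hj => by lia⟩, by simpa [partialIter_eq φ ha]⟩

/-- If `Fix(φ)` is normal in the base group, then every element of the HNN extension acts on it by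
conjugation like an element of the base group. -/
theorem exists_conj_eq_of_normal
    (hnormal : ∀ g a : G, a ∈ fixIter φ 1 → g * a * g⁻¹ ∈ fixIter φ 1)
    (x : HNNExtension G A B φ) :
    ∃ h : G, ∀ a ∈ fixIter φ 1, x * of a * x⁻¹ = of (h * a * h⁻¹) := by
  induction x using induction_on with
  | of g => exact ⟨g, fun a _ => by simp⟩
  | t =>
    refine ⟨1, fun a ha => ?_⟩
    obtain ⟨haA, h⟩ := (mem_fixIter_one φ).1 ha
    simpa [h] using (equiv_eq_conj (φ := φ) ⟨a, haA⟩).symm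
  | mul x y hx hy =>
    obtain ⟨h, hh⟩ := hx
    obtain ⟨h', hh'⟩ := hy
    refine ⟨h * h', fun a ha => ?_⟩
    have := hh _ (hnormal h' a ha)
    rw [← hh' a ha] at this
    simpa [mul_assoc] using this
  | inv x hx =>
    obtain ⟨h, hh⟩ := hx
    refine ⟨h⁻¹, fun a ha => ?_⟩
    have := hh _ (hnormal h⁻¹ a ha)
    have h' : h * (h⁻¹ * a * h⁻¹⁻¹) * h⁻¹ = a := by group
    rw [h'] at this
    rw [← this]
    group

theorem of_mem_FCCentre_of_mem_fixIter
    (hnormal : ∀ g a : G, a ∈ fixIter φ 1 → g * a * g⁻¹ ∈ fixIter φ 1) {g : G}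
    (hg : g ∈ FCCentre G) (hfix : g ∈ fixIter φ 1) :
    (of g : HNNExtension G A B φ) ∈ FCCentre _ := by
  rw [mem_FCCentre_iff] at hg ⊢
  let f : G ⧸ Subgroup.centralizer {g} →
      HNNExtension G A B φ ⧸ Subgroup.centralizer {(of g : HNNExtension G A B φ)} :=
    Quotient.map' of fun a b hab => by
      rw [QuotientGroup.leftRel_apply, Subgroup.mem_centralizer_singleton_iff] at hab ⊢
      simpa using congrArg (of (φ := φ)) hab
  have hf : Function.Surjective f := by
    intro y
    induction y using QuotientGroup.induction_on with
    | H x =>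
      obtain ⟨h, hh⟩ := exists_conj_eq_of_normal φ hnormal x
      refine ⟨(h : G ⧸ _), (QuotientGroup.eq (s := Subgroup.centralizer {of g})).2 ?_⟩
      rw [Subgroup.mem_centralizer_singleton_iff]
      have hc : x * of g = of h * of g * (of h)⁻¹ * x := by
        rw [← mul_inv_eq_iff_eq_mul, hh g hfix]
        simp
      rw [mul_assoc, hc]
      group
  have := Finite.of_surjective f hf
  exact Subgroup.finiteIndex_of_finite_quotient

end HNNExtension

/-- In the HNN extension `Γ = ⟨G, t | t⁻¹ a t = φ(a), a ∈ A⟩` with `A` a proper subgroup of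
`G`: if `F_∞ = ⋃_{k ≥ 1} F_k` equals `Fix(φ) = F_1` and `Fix(φ)` is a normal subgroup of `G`
(i.e. stable under conjugation), then the FC-centre of `Γ` equals the image under `G → Γ`
of `K(G) ∩ Fix(φ)`. -/
theorem fcCentre_hnnExtension_eq (G : Type*) [Group G] (A B : Subgroup G)
    (φ : A ≃* B) (hA : A ≠ ⊤)
    (hFinf : (⋃ k ∈ Set.Ici 1, fixIter φ k) = fixIter φ 1)
    (hnormal : ∀ g a : G, a ∈ fixIter φ 1 → g * a * g⁻¹ ∈ fixIter φ 1) :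
    (FCCentre (HNNExtension G A B φ) : Set (HNNExtension G A B φ)) =
      HNNExtension.of '' ((FCCentre G : Set G) ∩ fixIter φ 1) := by
  apply Set.Subset.antisymm
  · intro x hx
    obtain ⟨g, rfl⟩ := HNNExtension.exists_of_eq_of_mem_FCCentre φ hA hx
    refine ⟨g, ⟨HNNExtension.mem_FCCentre_of_of_mem φ hx, ?_⟩, rfl⟩
    obtain ⟨m, hm, hc⟩ := exists_commute_pow_of_mem_FCCentre hx HNNExtension.t
    rw [← hFinf]
    exact Set.mem_biUnion (Set.mem_Ici.2 hm) (HNNExtension.mem_fixIter_of_commute φ hc)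
  · rintro _ ⟨g, ⟨hg, hfix⟩, rfl⟩
    exact HNNExtension.of_mem_FCCentre_of_mem_fixIter φ hnormal hg hfix
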